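/- Let n be a positive integer, let E0, E1, E2 be real n×n matrices with E0 invertible, and let Z be the 2n×2n block matrix Z = [[E0⁻¹E1ᵀ, −E0⁻¹], [E1E0⁻¹E1ᵀ − E2, −E1E0⁻¹]]. Let λ be a real number and φu, φq ∈ ℝⁿ with Z(φu, φq) = λ(φu, φq). Then the function u : (0,∞) → ℝⁿ defined by u(ξ) = ξ^(−λ) φu is twice differentiable and satisfies the scaled boundary finite element equation in displacement E0 ξ² u″(ξ) + (E0 − E1 + E1ᵀ) ξ u′(ξ) − E2 u(ξ) = 0 for all ξ > 0. -/

import Mathlib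

open Matrix

/-- The displacement part of an eigenvector of the SBFEM block matrix solves the associated
quadratic eigenvalue problem `(λ² E0 + λ (E1 − E1ᵀ) − E2) φu = 0`. -/
theorem quadratic_eigenproblem_of_fromBlocks_mulVec {m : Type*} [Fintype m] [DecidableEq m]
    {E0 E1 E2 : Matrix m m ℝ} (hE0 : IsUnit E0) {lam : ℝ} {φu φq : m → ℝ}
    (h : (Matrix.fromBlocks (E0⁻¹ * E1ᵀ) (-E0⁻¹)
        (E1 * E0⁻¹ * E1ᵀ - E2) (-(E1 * E0⁻¹))).mulVec (Sum.elim φu φq) =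
      lam • Sum.elim φu φq) :
    lam ^ 2 • E0 *ᵥ φu + lam • (E1 *ᵥ φu - E1ᵀ *ᵥ φu) - E2 *ᵥ φu = 0 := by
  have hdet : IsUnit E0.det := (Matrix.isUnit_iff_isUnit_det E0).mp hE0
  rw [Matrix.fromBlocks_mulVec] at h
  have hu : E0⁻¹ *ᵥ (E1ᵀ *ᵥ φu - φq) = lam • φu := by
    ext i
    have := congrFun h (Sum.inl i)
    simp only [Sum.elim_comp_inl, Sum.elim_comp_inr, Matrix.neg_mulVec, Sum.elim_inl, Pi.add_apply,
      Pi.neg_apply, Pi.smul_apply, smul_eq_mul] at this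
    simp only [Matrix.mulVec_sub, Matrix.mulVec_mulVec, Pi.sub_apply, Pi.smul_apply, smul_eq_mul]
    linarith
  have hq : E1 *ᵥ (E0⁻¹ *ᵥ (E1ᵀ *ᵥ φu - φq)) - E2 *ᵥ φu = lam • φq := by
    ext i
    have := congrFun h (Sum.inr i)
    simp only [Sum.elim_comp_inl, Sum.elim_comp_inr, Matrix.sub_mulVec, Matrix.neg_mulVec,
      Sum.elim_inr, Pi.add_apply, Pi.sub_apply, Pi.neg_apply, Pi.smul_apply, smul_eq_mul] at this
    simp only [Matrix.mulVec_sub, Matrix.mulVec_mulVec, ← mul_assoc, Pi.sub_apply, Pi.smul_apply,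
      smul_eq_mul]
    linarith
  have hφq : E1ᵀ *ᵥ φu - φq = lam • E0 *ᵥ φu := by
    rw [← Matrix.mulVec_smul, ← hu, Matrix.mulVec_mulVec, Matrix.mul_nonsing_inv _ hdet,
      Matrix.one_mulVec]
  rw [hu, Matrix.mulVec_smul] at hq
  ext i
  have h1 := congrFun hφq i
  have h2 := congrFun hq i
  simp only [Pi.sub_apply, Pi.add_apply, Pi.smul_apply, smul_eq_mul, Pi.zero_apply] at h1 h2 ⊢
  linear_combination h2 - lam * h1

theorem hasDerivAt_rpow_smul {F : Type*} [NormedAddCommGroup F] [NormedSpace ℝ F] (p : ℝ) (v : F)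
    {x : ℝ} (hx : 0 < x) :
    HasDerivAt (fun y : ℝ => y ^ p • v) ((p * x ^ (p - 1)) • v) x :=
  (Real.hasDerivAt_rpow_const (Or.inl hx.ne')).smul_const v

/-- Each eigenpair `(λ, (φu, φq))` of the SBFEM block matrix `Z` yields a radial
displacement mode `u(ξ) = ξ^(−λ) φu` that is twice differentiable on `(0,∞)` and
satisfies the scaled boundary finite element equation in displacement
`E0 ξ² u″ + (E0 − E1 + E1ᵀ) ξ u′ − E2 u = 0`. -/
theorem sbfem_eigenmode_solves_displacement_equation
    (n : ℕ) (hn : 0 < n)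
    (E0 E1 E2 : Matrix (Fin n) (Fin n) ℝ) (hE0 : IsUnit E0)
    (Z : Matrix (Fin n ⊕ Fin n) (Fin n ⊕ Fin n) ℝ)
    (hZ : Z = Matrix.fromBlocks (E0⁻¹ * E1ᵀ) (-E0⁻¹)
        (E1 * E0⁻¹ * E1ᵀ - E2) (-(E1 * E0⁻¹)))
    (lam : ℝ) (φu φq : Fin n → ℝ)
    (heig : Z.mulVec (Sum.elim φu φq) = lam • Sum.elim φu φq)
    (u : ℝ → Fin n → ℝ)
    (hu : ∀ ξ : ℝ, u ξ = (ξ ^ (-lam) : ℝ) • φu) :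
    (∀ ξ : ℝ, 0 < ξ → DifferentiableAt ℝ u ξ) ∧
    (∀ ξ : ℝ, 0 < ξ → DifferentiableAt ℝ (deriv u) ξ) ∧
    (∀ ξ : ℝ, 0 < ξ →
      (ξ ^ 2) • E0.mulVec (deriv (deriv u) ξ)
        + ξ • (E0 - E1 + E1ᵀ).mulVec (deriv u ξ) - E2.mulVec (u ξ) = 0) := by
  obtain rfl : u = fun ξ : ℝ => ξ ^ (-lam) • φu := funext hu
  subst hZ
  have hquad := quadratic_eigenproblem_of_fromBlocks_mulVec hE0 heig
  have h1 (ξ : ℝ) (hξ : 0 < ξ) := hasDerivAt_rpow_smul (-lam) φu hξ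
  have h2 (ξ : ℝ) (hξ : 0 < ξ) :
      HasDerivAt (deriv fun ξ : ℝ => ξ ^ (-lam) • φu)
        (((-lam - 1) * ξ ^ (-lam - 1 - 1)) • -lam • φu) ξ := by
    refine (hasDerivAt_rpow_smul (-lam - 1) (-lam • φu) hξ).congr_of_eventuallyEq ?_
    filter_upwards [lt_mem_nhds hξ] with y hy
    rw [(h1 y hy).deriv, smul_smul, mul_comm]
  refine ⟨fun ξ hξ => (h1 ξ hξ).differentiableAt, fun ξ hξ => (h2 ξ hξ).differentiableAt,
    fun ξ hξ => ?_⟩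
  have hp1 : ξ * ξ ^ (-lam - 1) = ξ ^ (-lam) := by
    rw [Real.rpow_sub_one hξ.ne', mul_div_cancel₀ _ hξ.ne']
  have hp2 : ξ ^ 2 * ξ ^ (-lam - 1 - 1) = ξ ^ (-lam) := by
    rw [Real.rpow_sub_one hξ.ne', ← hp1]
    field_simp
  rw [(h2 ξ hξ).deriv, (h1 ξ hξ).deriv]
  ext i
  have hi := congrFun hquad i
  simp only [Matrix.mulVec_smul, Matrix.add_mulVec, Matrix.sub_mulVec, Pi.sub_apply, Pi.add_apply,
    Pi.smul_apply, smul_eq_mul, Pi.zero_apply] at hi ⊢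
  linear_combination ξ ^ (-lam) * hi + (lam + 1) * lam * (E0 *ᵥ φu) i * hp2
    - lam * ((E0 *ᵥ φu) i - (E1 *ᵥ φu) i + (E1ᵀ *ᵥ φu) i) * hp1
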